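/- Let σ = (σ_k)_{k≥0} be a sequence with each σ_k ∈ {L, M, R}. Then the language L_σ is factor-balanced if and only if σ_k ≠ M for infinitely many k. -/

import Mathlib

open List

/-- Number of occurrences of `v` as a factor of `w`, i.e. the number of
decompositions `w = p ++ v ++ s`. -/
def occ {A : Type*} [DecidableEq A] (v w : List A) : ℕ :=
  (List.range (w.length + 1)).countP (fun i => decide (v <+: w.drop i))

/-- Apply a substitution (given by its values on letters) to a word. -/
def applyS {A B : Type*} (σ : A → List B) (w : List A) : List B :=
  (w.map σ).flatten

/-- The substitution `L : 0 ↦ 0, 1 ↦ 10` (with `0 = false`, `1 = true`). -/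
def Lsub : Bool → List Bool
  | false => [false]
  | true => [true, false]

/-- The (Thue–Morse) substitution `M : 0 ↦ 01, 1 ↦ 10`. -/
def Msub : Bool → List Bool
  | false => [false, true]
  | true => [true, false]

/-- The substitution `R : 0 ↦ 01, 1 ↦ 1`. -/
def Rsub : Bool → List Bool
  | false => [false, true]
  | true => [true]

/-- For a sequence of substitutions `σ = (σ_k)`, the composition
`σ_{[0,n)} = σ_0 ∘ σ_1 ∘ ⋯ ∘ σ_{n-1}`, on letters. -/
def seg0 (σ : ℕ → Bool → List Bool) : ℕ → Bool → List Bool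
  | 0, a => [a]
  | n + 1, a => applyS (seg0 σ n) (σ n a)

/-- The language of the sequence `σ`: words that are factors of `σ_{[0,n)}(a)` for
some letter `a`, for infinitely many `n`. -/
def LangSeq (σ : ℕ → Bool → List Bool) : Set (List Bool) :=
  {w | {n : ℕ | ∃ a : Bool, w <:+: seg0 σ n a}.Infinite}

/-! ### Counting occurrences -/

section Occurrences

variable {A : Type*} {v : List A}

theorem prefix_append_iff_of_length_le {w : List A} (h : v.length ≤ w.length) (p : List A) :
    v <+: w ++ p ↔ v <+: w :=
  ⟨fun h' => List.prefix_of_prefix_length_le h' (List.prefix_append w p) h,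
    fun h' => h'.trans (List.prefix_append w p)⟩

variable [DecidableEq A]

theorem occ_nil_right (hv : v ≠ []) : occ v [] = 0 := by
  simp [occ, hv]

theorem occ_cons (v : List A) (a : A) (w : List A) :
    occ v (a :: w) = (if v <+: a :: w then 1 else 0) + occ v w := by
  unfold occ
  rw [List.length_cons, List.range_succ_eq_map, List.countP_cons, List.countP_map, add_comm]
  simp [Function.comp_def]

theorem occ_le_length (hv : v ≠ []) (w : List A) : occ v w ≤ w.length := by
  induction w with
  | nil => simp [occ_nil_right hv]
  | cons a w ih =>
    rw [occ_cons, List.length_cons]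
    split_ifs <;> omega

theorem le_occ_append_right (hv : v ≠ []) (w p : List A) : occ v w ≤ occ v (w ++ p) := by
  induction w with
  | nil => simp [occ_nil_right hv]
  | cons a w ih =>
    rw [List.cons_append, occ_cons, occ_cons]
    by_cases h : v <+: a :: w
    · have : v <+: a :: (w ++ p) := h.trans (List.prefix_append (a :: w) p)
      simp only [h, this, if_true]; omega
    · simp only [h, if_false]; omega

theorem occ_append_le (hv : v ≠ []) (w p : List A) :
    occ v (w ++ p) ≤ occ v w + (v.length + p.length) := by
  induction w with
  | nil =>
    have := occ_le_length hv p
    simp only [List.nil_append]; omega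
  | cons a w ih =>
    by_cases h : v.length ≤ (a :: w).length
    · have := prefix_append_iff_of_length_le h p
      rw [List.cons_append] at this
      rw [List.cons_append, occ_cons, occ_cons]
      simp only [this]; omega
    · have := occ_le_length hv (a :: w ++ p)
      simp only [List.length_append] at this
      omega

theorem occ_append_left (v s w : List A) :
    occ v w ≤ occ v (s ++ w) ∧ occ v (s ++ w) ≤ s.length + occ v w := by
  induction s with
  | nil => simp
  | cons a s ih =>
    rw [List.cons_append, occ_cons, List.length_cons]
    split_ifs <;> omega

theorem occ_overlap {s : List A} (hs : v.length ≤ s.length + 1) (p t : List A) :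
    occ v (p ++ (s ++ t)) + occ v s = occ v (p ++ s) + occ v (s ++ t) := by
  induction p with
  | nil => simp [add_comm]
  | cons a p ih =>
    have h : v.length ≤ (a :: (p ++ s)).length := by
      simp only [List.length_cons, List.length_append]; omega
    have h' := prefix_append_iff_of_length_le h t
    simp only [List.cons_append, List.append_assoc] at h' ⊢
    rw [occ_cons, occ_cons]
    simp only [h']; omega

theorem abs_occ_append_append_sub_le (hv : v ≠ []) (s w p : List A) :
    |(occ v (s ++ (w ++ p)) : ℤ) - occ v w| ≤ s.length + v.length + p.length := by
  have h1 := occ_append_left v s (w ++ p)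
  have h2 := occ_append_le hv w p
  have h3 := le_occ_append_right hv w p
  rw [abs_le]
  constructor <;> omega

end Occurrences

/-! ### Substitutions -/

section Substitutions

variable {A B D : Type*}

@[simp] theorem applyS_nil (τ : A → List B) : applyS τ [] = [] := rfl

@[simp] theorem applyS_cons (τ : A → List B) (a : A) (w : List A) :
    applyS τ (a :: w) = τ a ++ applyS τ w := rfl

@[simp] theorem applyS_append (τ : A → List B) (u w : List A) :
    applyS τ (u ++ w) = applyS τ u ++ applyS τ w := by
  simp [applyS]

theorem applyS_applyS (τ : B → List D) (ρ : A → List B) (w : List A) :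
    applyS τ (applyS ρ w) = applyS (fun a => applyS τ (ρ a)) w := by
  induction w with
  | nil => rfl
  | cons a w ih => simp [ih]

theorem applyS_singleton_fun (w : List A) : applyS (fun a => [a]) w = w := by
  induction w with
  | nil => rfl
  | cons a w ih => simp [ih]

theorem applyS_infix (τ : A → List B) {u w : List A} (h : u <:+: w) :
    applyS τ u <:+: applyS τ w := by
  obtain ⟨s, t, rfl⟩ := h
  exact ⟨applyS τ s, applyS τ t, by simp⟩

theorem prefix_append_cases {w x y : List A} (h : w <+: x ++ y) :
    w <+: x ∨ ∃ z, w = x ++ z ∧ z <+: y := by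
  rcases le_total w.length x.length with hl | hl
  · exact .inl ((prefix_append_iff_of_length_le hl y).1 h)
  · obtain ⟨z, rfl⟩ := List.prefix_of_prefix_length_le (List.prefix_append x y) h hl
    exact .inr ⟨z, rfl, by simpa using h⟩

theorem exists_of_prefix_applyS (τ : A → List B) {K : ℕ} (hK : ∀ a, (τ a).length ≤ K)
    (u : List A) (w : List B) (h : w <+: applyS τ u) :
    ∃ y p, w = applyS τ y ++ p ∧ y <+: u ∧ p.length ≤ K := by
  induction u generalizing w with
  | nil => exact ⟨[], [], by simpa using h, List.nil_prefix, by simp⟩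
  | cons a u ih =>
    rcases prefix_append_cases h with h' | ⟨w', rfl, h'⟩
    · exact ⟨[], w, rfl, List.nil_prefix, h'.length_le.trans (hK a)⟩
    · obtain ⟨y, p, rfl, hy, hp⟩ := ih w' h'
      exact ⟨a :: y, p, by simp, by simpa using hy, hp⟩

theorem exists_of_infix_applyS (τ : A → List B) {K : ℕ} (hK : ∀ a, (τ a).length ≤ K)
    (u : List A) (w : List B) (h : w <:+: applyS τ u) :
    ∃ s y p, w = s ++ (applyS τ y ++ p) ∧ y <:+: u ∧ s.length ≤ K ∧ p.length ≤ K := by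
  induction u with
  | nil => exact ⟨[], [], [], by simpa using h, by simp, by simp, by simp⟩
  | cons a u ih =>
    rw [applyS_cons, List.infix_append_iff] at h
    rcases h with h | h | ⟨s, q, rfl, hs, hq⟩
    · exact ⟨w, [], [], by simp, List.nil_infix, h.length_le.trans (hK a), by simp⟩
    · obtain ⟨s, y, p, hw, hy, hs, hp⟩ := ih h
      exact ⟨s, y, p, hw, List.infix_cons hy, hs, hp⟩
    · obtain ⟨y, p, rfl, hy, hp⟩ := exists_of_prefix_applyS τ hK u q hq
      exact ⟨s, y, p, rfl, List.infix_cons hy.isInfix, hs.length_le.trans (hK a), hp⟩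

theorem length_applyS_bool (τ : Bool → List B) (u : List Bool) :
    (applyS τ u).length =
      u.count true * (τ true).length + u.count false * (τ false).length := by
  induction u with
  | nil => simp
  | cons a u ih => cases a <;> simp [ih] <;> ring

theorem length_le_length_applyS {τ : A → List B} (hτ : ∀ a, τ a ≠ []) (u : List A) :
    u.length ≤ (applyS τ u).length := by
  induction u with
  | nil => simp
  | cons a u ih =>
    have := List.length_pos_iff.2 (hτ a)
    simp only [applyS_cons, List.length_append, List.length_cons]; omega

/-- If both letter images end with a common word `s` as long as `v` (up to one letter), occurrences
of `v` in images are counted by the letters of the preimage. -/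
theorem occ_append_applyS [DecidableEq B] {v s : List B} (hs : v.length ≤ s.length + 1)
    {τ : Bool → List B} (hτ : ∀ a, s <:+ τ a) (u : List Bool) :
    (occ v (s ++ applyS τ u) : ℤ) = occ v s
      + u.count true * ((occ v (s ++ τ true) : ℤ) - occ v s)
      + u.count false * ((occ v (s ++ τ false) : ℤ) - occ v s) := by
  induction u with
  | nil => simp
  | cons a u ih =>
    obtain ⟨q, hq⟩ := hτ a
    have h := occ_overlap hs (s ++ q) (applyS τ u)
    have e : s ++ applyS τ (a :: u) = s ++ q ++ (s ++ applyS τ u) := by simp [← hq]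
    have e' : s ++ q ++ s = s ++ τ a := by simp [← hq]
    rw [e]
    rw [e'] at h
    have h' : (occ v (s ++ q ++ (s ++ applyS τ u)) : ℤ)
        = occ v (s ++ τ a) + occ v (s ++ applyS τ u) - occ v s := by
      have := congrArg (Nat.cast : ℕ → ℤ) h
      push_cast at this; linarith
    rw [h', ih]
    cases a <;> simp <;> ring

end Substitutions

/-! ### Desubstitution and balance -/

section Desubstitution

/-- In words of the set `Y`, longer words have at most two fewer occurrences of each letter. -/
def LetterBalanced (Y : Set (List Bool)) : Prop :=
  ∀ c : Bool, ∀ x ∈ Y, ∀ y ∈ Y, x.length ≤ y.length → x.count c ≤ y.count c + 2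

theorem count_add_count_not (b : Bool) (x : List Bool) :
    x.count b + x.count (!b) = x.length := by
  have := List.count_true_add_count_false x
  cases b
  · rwa [add_comm] at this
  · exact this

theorem LetterBalanced.of_letter {Y : Set (List Bool)}
    (hY : ∀ y ∈ Y, ∀ x, x <:+: y → x ∈ Y) (b : Bool)
    (h : ∀ x ∈ Y, ∀ y ∈ Y, x.length ≤ y.length → x.count b ≤ y.count b + 2) :
    LetterBalanced Y := by
  intro c x hx y hy hxy
  by_cases hc : c = b
  · subst hc; exact h x hx y hy hxy
  have hc : c = !b := by cases c <;> cases b <;> simp_all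
  subst hc
  have hp : y.take x.length <+: y := List.take_prefix _ _
  have hl : (y.take x.length).length = x.length := by simp [hxy]
  have h1 := h _ (hY y hy _ hp.isInfix) x hx hl.le
  have h2 := count_add_count_not b x
  have h3 := count_add_count_not b (y.take x.length)
  have h4 := hp.sublist.count_le (!b)
  omega

theorem count_le_of_length_applyS_le {Y : Set (List Bool)}
    (hY : ∀ y ∈ Y, ∀ x, x <:+: y → x ∈ Y) (hbal : LetterBalanced Y)
    {τ : Bool → List Bool} (hτ : ∀ a, τ a ≠ []) {N : ℕ} {x y : List Bool} (hx : x ∈ Y) (hy : y ∈ Y)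
    (h : (applyS τ y).length ≤ (applyS τ x).length + N) (c : Bool) :
    y.count c ≤ x.count c + (2 + N + 2 * (τ true).length + 2 * (τ false).length) := by
  rcases le_total y.length x.length with hl | hl
  · have := hbal c y hy x hx hl
    omega
  · obtain ⟨p, r, rfl, hp⟩ : ∃ p r, y = p ++ r ∧ p.length = x.length :=
      ⟨y.take x.length, y.drop x.length, by simp, by simp [hl]⟩
    have hpY : p ∈ Y := hY _ hy _ List.infix_append_left
    have h1 := hbal true x hx p hpY hp.ge
    have h2 := hbal false x hx p hpY hp.ge
    have h3 := hbal c p hpY x hx hp.le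
    have h4 := length_le_length_applyS hτ r
    have h5 := List.count_le_length (a := c) (l := r)
    have h6 := length_applyS_bool τ x
    have h7 := length_applyS_bool τ p
    have h8 := Nat.mul_le_mul_right (τ true).length h1
    have h9 := Nat.mul_le_mul_right (τ false).length h2
    rw [applyS_append, List.length_append] at h
    rw [List.count_append]
    rw [add_mul] at h8 h9
    omega

theorem exists_bound_of_common_suffix {X Y : Set (List Bool)}
    (hY : ∀ y ∈ Y, ∀ x, x <:+: y → x ∈ Y) (hbal : LetterBalanced Y)
    {τ : Bool → List Bool} (hτ : ∀ a, τ a ≠ []) {n K : ℕ} (hn : 1 ≤ n) {s : List Bool}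
    (hs : n ≤ s.length + 1) (hsτ : ∀ a, s <:+ τ a)
    (hX : ∀ w ∈ X, ∃ l y r, w = l ++ (applyS τ y ++ r) ∧ y ∈ Y ∧ l.length ≤ K ∧ r.length ≤ K) :
    ∃ C : ℕ, ∀ v : List Bool, v.length = n → ∀ w ∈ X, ∀ w' ∈ X, w.length = w'.length →
      |(occ v w : ℤ) - (occ v w' : ℤ)| ≤ (C : ℤ) := by
  set E := 2 + 2 * K + 2 * (τ true).length + 2 * (τ false).length
  refine ⟨2 * (2 * K + n + s.length) + E * (2 * s.length + (τ true).length) +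
    E * (2 * s.length + (τ false).length), ?_⟩
  intro v hv w hw w' hw' hlen
  have hv0 : v ≠ [] := by rintro rfl; simp at hv; omega
  obtain ⟨l, y, r, rfl, hy, hl, hr⟩ := hX w hw
  obtain ⟨l', y', r', rfl, hy', hl', hr'⟩ := hX w' hw'
  simp only [List.length_append] at hlen
  have close : ∀ c, |(y.count c : ℤ) - y'.count c| ≤ E := by
    intro c
    have h1 := count_le_of_length_applyS_le hY hbal hτ (N := 2 * K) hy hy' (by omega) c
    have h2 := count_le_of_length_applyS_le hY hbal hτ (N := 2 * K) hy' hy (by omega) c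
    rw [abs_le]; constructor <;> omega
  have coef : ∀ c, |(occ v (s ++ τ c) : ℤ) - occ v s| ≤ 2 * s.length + (τ c).length := by
    intro c
    have h1 := occ_le_length hv0 (s ++ τ c)
    have h2 := occ_le_length hv0 s
    rw [List.length_append] at h1
    rw [abs_le]; constructor <;> omega
  have e1 := occ_append_applyS (hv.le.trans hs) hsτ y
  have e2 := occ_append_applyS (hv.le.trans hs) hsτ y'
  have a1 := abs_le.1 (abs_occ_append_append_sub_le hv0 l (applyS τ y) r)
  have a2 := abs_le.1 (abs_occ_append_append_sub_le hv0 l' (applyS τ y') r')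
  have b1 := occ_append_left v s (applyS τ y)
  have b2 := occ_append_left v s (applyS τ y')
  have key : ∀ c, |((y.count c : ℤ) - y'.count c) * ((occ v (s ++ τ c) : ℤ) - occ v s)|
      ≤ E * (2 * s.length + (τ c).length) := fun c => by
    rw [abs_mul]
    exact mul_le_mul (close c) (coef c) (abs_nonneg _) (by positivity)
  have m1 := abs_le.1 (key true)
  have m2 := abs_le.1 (key false)
  push_cast
  rw [sub_mul] at m1 m2
  rw [abs_le]
  constructor <;> omega

end Desubstitution

/-! ### The substitutions `L`, `M`, `R` and letter balance -/

section LetterBalance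

/-- The substitution fixing `a` and sending the other letter `b` to `ba`; it is `L` for `a = 0` and
`R` for `a = 1`. -/
def sturmSub (a : Bool) : Bool → List Bool := fun c => if c = a then [a] else [!a, a]

theorem Lsub_eq : Lsub = sturmSub false := by
  funext c; cases c <;> rfl

theorem Rsub_eq : Rsub = sturmSub true := by
  funext c; cases c <;> rfl

theorem Msub_apply (c : Bool) : Msub c = [c, !c] := by
  cases c <;> rfl

@[simp] theorem sturmSub_self (a : Bool) : sturmSub a a = [a] := by simp [sturmSub]

@[simp] theorem sturmSub_not (a : Bool) : sturmSub a (!a) = [!a, a] := by simp [sturmSub]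

theorem exists_of_prefix_sturmSub (a : Bool) (u w : List Bool) (h : w <+: applyS (sturmSub a) u) :
    ∃ y, y <+: u ∧ y.count (!a) = w.count (!a) ∧
      w.length ≤ y.length + w.count (!a) ∧ y.length + w.count (!a) ≤ w.length + 1 := by
  induction u generalizing w with
  | nil => exact ⟨[], List.nil_prefix, by simp_all⟩
  | cons c u ih =>
    have hc : c = a ∨ c = !a := by cases c <;> cases a <;> simp
    rcases hc with rfl | rfl
    · rw [applyS_cons, sturmSub_self, List.singleton_append, List.prefix_cons_iff] at h
      rcases h with rfl | ⟨w, rfl, h⟩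
      · exact ⟨[], List.nil_prefix, by simp⟩
      · obtain ⟨y, hy, h1, h2, h3⟩ := ih w h
        refine ⟨c :: y, by simpa using hy, ?_, ?_, ?_⟩ <;> simp <;> omega
    · rw [applyS_cons, sturmSub_not, List.cons_append, List.singleton_append,
        List.prefix_cons_iff] at h
      rcases h with rfl | ⟨w, rfl, h⟩
      · exact ⟨[], List.nil_prefix, by simp⟩
      rw [List.prefix_cons_iff] at h
      rcases h with rfl | ⟨w, rfl, h⟩
      · exact ⟨[!a], by simp, by simp⟩
      · obtain ⟨y, hy, h1, h2, h3⟩ := ih w h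
        refine ⟨(!a) :: y, by simpa using hy, ?_, ?_, ?_⟩ <;> simp <;> omega

theorem exists_of_infix_sturmSub (a : Bool) (u w : List Bool) (h : w <:+: applyS (sturmSub a) u) :
    ∃ y, y <:+: u ∧ y.count (!a) = w.count (!a) ∧
      w.length ≤ y.length + w.count (!a) + 1 ∧ y.length + w.count (!a) ≤ w.length + 1 := by
  induction u with
  | nil => exact ⟨[], List.nil_infix, by simp_all⟩
  | cons c u ih =>
    by_cases hp : w <+: applyS (sturmSub a) (c :: u)
    · obtain ⟨y, hy, h1, h2, h3⟩ := exists_of_prefix_sturmSub a _ w hp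
      exact ⟨y, hy.isInfix, h1, by omega, h3⟩
    suffices h' : w <:+: applyS (sturmSub a) u ∨ ∃ z, w = a :: z ∧ z <+: applyS (sturmSub a) u by
      rcases h' with h' | ⟨z, rfl, hz⟩
      · obtain ⟨y, hy, h'⟩ := ih h'
        exact ⟨y, List.infix_cons hy, h'⟩
      · obtain ⟨y, hy, h1, h2, h3⟩ := exists_of_prefix_sturmSub a _ z hz
        refine ⟨y, List.infix_cons hy.isInfix, ?_, ?_, ?_⟩ <;> simp <;> omega
    have hc : c = a ∨ c = !a := by cases c <;> cases a <;> simp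
    rcases hc with rfl | rfl
    · rw [applyS_cons, sturmSub_self, List.singleton_append] at h hp
      rw [List.infix_cons_iff] at h
      exact .inl (h.resolve_left hp)
    · rw [applyS_cons, sturmSub_not, List.cons_append, List.singleton_append] at h hp
      rw [List.infix_cons_iff] at h
      have h := h.resolve_left hp
      rw [List.infix_cons_iff, List.prefix_cons_iff] at h
      rcases h with (rfl | h) | h
      · exact .inl List.nil_infix
      · exact .inr h
      · exact .inl h

theorem of_prefix_Msub (u w : List Bool) (h : w <+: applyS Msub u) (c : Bool) :
    w.length ≤ 2 * w.count c + 1 ∧ 2 * w.count c ≤ w.length + 1 := by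
  induction u generalizing w with
  | nil => simp_all
  | cons d u ih =>
    rw [applyS_cons, Msub_apply, List.cons_append, List.singleton_append,
      List.prefix_cons_iff] at h
    rcases h with rfl | ⟨w, rfl, h⟩
    · simp
    rw [List.prefix_cons_iff] at h
    rcases h with rfl | ⟨w, rfl, h⟩
    · cases c <;> cases d <;> simp
    · have := ih w h
      cases c <;> cases d <;> simp <;> omega

theorem of_infix_Msub (u w : List Bool) (h : w <:+: applyS Msub u) (c : Bool) :
    w.length ≤ 2 * w.count c + 2 ∧ 2 * w.count c ≤ w.length + 2 := by
  induction u with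
  | nil => simp_all
  | cons d u ih =>
    rw [applyS_cons, Msub_apply, List.cons_append, List.singleton_append,
      List.infix_cons_iff, List.infix_cons_iff] at h
    rcases h with h | h | h
    · have := of_prefix_Msub (d :: u) w (by simpa [Msub_apply] using h) c
      omega
    · rw [List.prefix_cons_iff] at h
      rcases h with rfl | ⟨w, rfl, h⟩
      · simp
      · have := of_prefix_Msub u w h c
        cases c <;> cases d <;> simp <;> omega
    · exact ih h

theorem infix_closed (z : List Bool) :
    ∀ y ∈ {y | y <:+: z}, ∀ x, x <:+: y → x ∈ {y | y <:+: z} :=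
  fun _ hy _ hx => hx.trans hy

theorem LetterBalanced.sturmSub (a : Bool) {z : List Bool} (h : LetterBalanced {y | y <:+: z}) :
    LetterBalanced {y | y <:+: applyS (sturmSub a) z} := by
  refine .of_letter (infix_closed _) (!a) fun x hx y hy hxy => ?_
  obtain ⟨x', hx', h1, h2, h3⟩ := exists_of_infix_sturmSub a z x hx
  obtain ⟨y', hy', h4, h5, h6⟩ := exists_of_infix_sturmSub a z y hy
  by_contra! hlt
  have := h (!a) x' hx' y' hy' (by omega)
  omega

theorem letterBalanced_Msub (z : List Bool) : LetterBalanced {y | y <:+: applyS Msub z} := by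
  intro c x hx y hy hxy
  have h1 := of_infix_Msub z x hx c
  have h2 := of_infix_Msub z y hy c
  omega

theorem letterBalanced_singleton (b : Bool) : LetterBalanced {y | y <:+: [b]} := by
  intro c x hx y _ _
  have h1 := List.IsInfix.length_le hx
  have h2 := List.count_le_length (a := c) (l := x)
  simp only [List.length_singleton] at h1
  omega

end LetterBalance

/-! ### Directive sequences -/

section Sequences

variable {σ : ℕ → Bool → List Bool}

theorem seg0_add (σ : ℕ → Bool → List Bool) (k m : ℕ) (b : Bool) :
    seg0 σ (k + m) b = applyS (seg0 σ k) (seg0 (fun i => σ (k + i)) m b) := by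
  induction m generalizing b with
  | zero => simp [seg0]
  | succ m ih =>
    rw [← add_assoc, seg0, seg0, applyS_applyS]
    congr 1
    funext a
    exact ih a

theorem seg0_one_add (σ : ℕ → Bool → List Bool) (m : ℕ) (b : Bool) :
    seg0 σ (m + 1) b = applyS (σ 0) (seg0 (fun i => σ (i + 1)) m b) := by
  rw [add_comm m 1, seg0_add]
  simp only [add_comm 1]
  congr 1
  funext a
  exact applyS_singleton_fun (σ 0 a)

/-- The sequence takes its values in `{L, M, R}`. -/
def IsLMR (σ : ℕ → Bool → List Bool) : Prop := ∀ k, (∃ a, σ k = sturmSub a) ∨ σ k = Msub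

theorem IsLMR.shift (h : IsLMR σ) (k : ℕ) : IsLMR fun i => σ (k + i) := fun i => h (k + i)

theorem IsLMR.letterBalanced (h : IsLMR σ) (m : ℕ) (b : Bool) :
    LetterBalanced {y | y <:+: seg0 σ m b} := by
  induction m generalizing σ with
  | zero => exact letterBalanced_singleton b
  | succ m ih =>
    rw [seg0_one_add]
    rcases h 0 with ⟨a, ha⟩ | h0
    · rw [ha]
      exact (ih fun i => h (i + 1)).sturmSub a
    · rw [h0]
      exact letterBalanced_Msub _

theorem infix_applyS_of_mem {τ : Bool → List Bool} {a : Bool} {w : List Bool} (h : a ∈ w) :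
    τ a <:+: applyS τ w := by
  obtain ⟨s, t, rfl⟩ := List.append_of_mem h
  exact ⟨applyS τ s, applyS τ t, by simp⟩

theorem IsLMR.exists_mem (h : IsLMR σ) (k : ℕ) : ∃ b, ∀ a, a ∈ σ k b := by
  rcases h k with ⟨a, ha⟩ | hM
  · exact ⟨!a, fun c => by rw [ha]; cases a <;> cases c <;> simp [_root_.sturmSub]⟩
  · exact ⟨true, fun c => by rw [hM]; cases c <;> simp [Msub]⟩

theorem IsLMR.exists_seg0_infix (h : IsLMR σ) {n m : ℕ} (hnm : n < m) :
    ∃ b, ∀ a, seg0 σ n a <:+: seg0 σ m b := by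
  induction m, hnm using Nat.le_induction with
  | base =>
    obtain ⟨b, hb⟩ := h.exists_mem n
    exact ⟨b, fun a => infix_applyS_of_mem (hb a)⟩
  | succ m _ ih =>
    obtain ⟨b, hb⟩ := ih
    obtain ⟨c, hc⟩ := h.exists_mem m
    exact ⟨c, fun a => (hb a).trans (infix_applyS_of_mem (hc b))⟩

/-- All factors of the words `σ_{[0,n)}(a)`. -/
def segFactors (σ : ℕ → Bool → List Bool) : Set (List Bool) := {w | ∃ n a, w <:+: seg0 σ n a}

theorem IsLMR.letterBalanced_segFactors (h : IsLMR σ) : LetterBalanced (segFactors σ) := by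
  rintro c x ⟨n, a, hx⟩ y ⟨m, b, hy⟩ hxy
  obtain ⟨a', ha'⟩ := h.exists_seg0_infix (show n < n + m + 1 by omega)
  obtain ⟨b', hb'⟩ := h.exists_seg0_infix (show m < n + m + 1 by omega)
  obtain ⟨d, hd⟩ := h.exists_seg0_infix (Nat.lt_succ_self (n + m + 1))
  exact h.letterBalanced _ d c x (hx.trans ((ha' a).trans (hd a'))) y
    (hy.trans ((hb' b).trans (hd b'))) hxy

theorem segFactors_closed (σ : ℕ → Bool → List Bool) :
    ∀ y ∈ segFactors σ, ∀ x, x <:+: y → x ∈ segFactors σ := by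
  rintro y ⟨n, a, hy⟩ x hx
  exact ⟨n, a, hx.trans hy⟩

end Sequences

/-! ### Infinitely many `L` or `R` give factor balance -/

section Balanced

variable {σ : ℕ → Bool → List Bool}

theorem sturmSub_ne_nil (a c : Bool) : sturmSub a c ≠ [] := by
  cases a <;> cases c <;> simp [sturmSub]

theorem IsLMR.mem_self (h : IsLMR σ) (k : ℕ) (a : Bool) : a ∈ σ k a := by
  rcases h k with ⟨b, hb⟩ | hM
  · rw [hb]; cases a <;> cases b <;> simp [_root_.sturmSub]
  · rw [hM]; cases a <;> simp [Msub]

theorem IsLMR.seg0_ne_nil (h : IsLMR σ) (k : ℕ) (a : Bool) : seg0 σ k a ≠ [] := by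
  induction k with
  | zero => simp [seg0]
  | succ k ih =>
    have := (infix_applyS_of_mem (τ := seg0 σ k) (h.mem_self k a)).length_le
    have := List.length_pos_iff.2 ih
    rw [← List.length_pos_iff]
    rw [seg0]; omega

theorem IsLMR.length_seg0_mono (h : IsLMR σ) (a : Bool) :
    Monotone fun k => (seg0 σ k a).length :=
  monotone_nat_of_le_succ fun k =>
    (infix_applyS_of_mem (τ := seg0 σ k) (h.mem_self k a)).length_le

theorem IsLMR.length_seg0_lt (h : IsLMR σ) {a : Bool} {k : ℕ} (hk : σ k ≠ sturmSub a) :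
    (seg0 σ k a).length < (seg0 σ (k + 1) a).length := by
  have h1 := List.length_pos_iff.2 (h.seg0_ne_nil k (!a))
  rw [seg0]
  rcases h k with ⟨b, hb⟩ | hM
  · have hba : b = !a := by
      cases a <;> cases b <;> simp_all
    subst hba
    have := sturmSub_not (!a)
    rw [Bool.not_not] at this
    rw [hb, this]
    simp; omega
  · rw [hM, Msub_apply]
    simp; omega

theorem IsLMR.exists_le_length_seg0 (h : IsLMR σ) {a : Bool}
    (ha : {k | σ k ≠ sturmSub a}.Infinite) (l : ℕ) : ∃ k, l ≤ (seg0 σ k a).length := by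
  induction l with
  | zero => exact ⟨0, Nat.zero_le _⟩
  | succ l ih =>
    obtain ⟨k, hk⟩ := ih
    obtain ⟨m, hm, hkm⟩ := ha.exists_gt k
    have h1 := h.length_seg0_mono a hkm.le
    have h2 := h.length_seg0_lt hm
    simp only at h1
    exact ⟨m + 1, by omega⟩

theorem exists_of_mem_LangSeq {w : List Bool} (hw : w ∈ LangSeq σ) (k : ℕ) :
    ∃ r b, w <:+: applyS (seg0 σ k) (seg0 (fun i => σ (k + i)) r b) := by
  obtain ⟨m, ⟨b, hb⟩, hm⟩ := Set.Infinite.exists_gt hw k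
  refine ⟨m - k, b, ?_⟩
  rwa [← seg0_add, Nat.add_sub_cancel' hm.le]

theorem length_le_sum (τ : Bool → List Bool) (c : Bool) :
    (τ c).length ≤ (τ true).length + (τ false).length := by
  cases c <;> simp

theorem IsLMR.balanced_of_infinite (h : IsLMR σ) {a : Bool}
    (ha : {k | σ k = sturmSub a}.Infinite) (ha' : {k | σ k ≠ sturmSub a}.Infinite)
    {n : ℕ} (hn : 1 ≤ n) :
    ∃ C : ℕ, ∀ v : List Bool, v.length = n → ∀ w ∈ LangSeq σ, ∀ w' ∈ LangSeq σ,
      w.length = w'.length → |(occ v w : ℤ) - (occ v w' : ℤ)| ≤ (C : ℤ) := by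
  obtain ⟨k₀, hk₀⟩ := h.exists_le_length_seg0 ha' n
  obtain ⟨k, hk, hk'⟩ := ha.exists_gt k₀
  have hlen := hk₀.trans (h.length_seg0_mono a hk'.le)
  refine exists_bound_of_common_suffix (segFactors_closed fun i => σ (k + 1 + i))
    (h.shift (k + 1)).letterBalanced_segFactors (h.seg0_ne_nil (k + 1)) hn
    (K := (seg0 σ (k + 1) true).length + (seg0 σ (k + 1) false).length)
    (s := seg0 σ k a) (hlen.trans (Nat.le_succ _)) (fun c => ?_) fun w hw => ?_
  · rw [seg0, show σ k = sturmSub a from hk]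
    unfold sturmSub
    split_ifs
    · simp
    · exact ⟨seg0 σ k (!a), by simp⟩
  · obtain ⟨r, b, hw⟩ := exists_of_mem_LangSeq hw (k + 1)
    obtain ⟨s, y, p, rfl, hy, hs, hp⟩ := exists_of_infix_applyS _ (length_le_sum _) _ _ hw
    exact ⟨s, y, p, rfl, ⟨r, b, hy⟩, hs, hp⟩

theorem seg0_sturmSub_infix (a : Bool) (r : ℕ) (b : Bool) :
    seg0 (fun _ => sturmSub a) r b <:+: (!a) :: List.replicate (r + 1) a := by
  have key : seg0 (fun _ => sturmSub a) r a = [a] ∧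
      seg0 (fun _ => sturmSub a) r (!a) = (!a) :: List.replicate r a := by
    induction r with
    | zero => simp [seg0]
    | succ r ih => simp [seg0, ih, ← List.replicate_succ']
  have hb : b = a ∨ b = !a := by cases a <;> cases b <;> simp
  rcases hb with rfl | rfl
  · rw [key.1]
    exact ⟨[!b], List.replicate r b, by simp [List.replicate_succ]⟩
  · rw [key.2]
    exact ⟨[], [a], by simp [← List.replicate_succ']⟩

theorem letterBalanced_replicate (a : Bool) : LetterBalanced {y | ∃ j, y = List.replicate j a} := by
  rintro c _ ⟨i, rfl⟩ _ ⟨j, rfl⟩ hij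
  simp only [List.length_replicate, List.count_replicate] at *
  split_ifs <;> omega

theorem infix_replicate {a : Bool} {r : ℕ} {y : List Bool} (h : y <:+: List.replicate r a) :
    ∃ j, y = List.replicate j a :=
  ⟨y.length, List.eq_replicate_of_mem fun _ hb => List.eq_of_mem_replicate (h.subset hb)⟩

theorem applyS_replicate_mul (τ : Bool → List Bool) (a : Bool) (n q : ℕ) :
    applyS τ (List.replicate (n * q) a) =
      applyS (fun _ => applyS τ (List.replicate n a)) (List.replicate q a) := by
  induction q with
  | zero => simp
  | succ q ih =>
    rw [Nat.mul_succ, add_comm, List.replicate_add, applyS_append, ih, List.replicate_succ,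
      applyS_cons]

theorem exists_applyS_replicate_eq (τ : Bool → List Bool) (a : Bool) {n : ℕ} (hn : 1 ≤ n) (j : ℕ) :
    ∃ q t, applyS τ (List.replicate j a) =
      applyS (fun _ => applyS τ (List.replicate n a)) (List.replicate q a) ++ t ∧
        t.length ≤ n * ((τ true).length + (τ false).length) := by
  refine ⟨j / n, applyS τ (List.replicate (j % n) a), ?_, ?_⟩
  · rw [← applyS_replicate_mul, ← applyS_append, ← List.replicate_add, Nat.div_add_mod]
  · have : (applyS τ (List.replicate (j % n) a)).length = (j % n) * (τ a).length := by
      simp [applyS]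
    rw [this]
    exact Nat.mul_le_mul (Nat.mod_lt j hn).le (length_le_sum τ a)

theorem exists_of_infix_applyS_cons_replicate (τ : Bool → List Bool) (a : Bool) {n r K : ℕ}
    (hn : 1 ≤ n) {w : List Bool} (hw : w <:+: applyS τ ((!a) :: List.replicate r a))
    (hK : K = (τ true).length + (τ false).length) :
    ∃ l q t, w = l ++ (applyS (fun _ => applyS τ (List.replicate n a)) (List.replicate q a) ++ t) ∧
      l.length ≤ 2 * K + n * K ∧ t.length ≤ 2 * K + n * K := by
  obtain ⟨s, y, p, rfl, hy, hs, hp⟩ := exists_of_infix_applyS _ (length_le_sum _) _ _ hw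
  rw [← hK] at hs hp
  rw [List.infix_cons_iff, List.prefix_cons_iff] at hy
  rcases hy with (rfl | ⟨y, rfl, hy⟩) | hy
  · exact ⟨s, 0, p, by simp, by omega, by omega⟩
  · obtain ⟨j, rfl⟩ := infix_replicate hy.isInfix
    obtain ⟨q, t, e, ht⟩ := exists_applyS_replicate_eq τ a hn j
    have := length_le_sum τ (!a)
    rw [← hK] at ht this
    refine ⟨s ++ τ (!a), q, t ++ p, ?_, ?_, ?_⟩
    · rw [applyS_cons, e]
      simp only [List.append_assoc]
    · rw [List.length_append]; omega
    · rw [List.length_append]; omega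
  · obtain ⟨j, rfl⟩ := infix_replicate hy
    obtain ⟨q, t, e, ht⟩ := exists_applyS_replicate_eq τ a hn j
    rw [← hK] at ht
    refine ⟨s, q, t ++ p, ?_, by omega, ?_⟩
    · rw [e]
      simp only [List.append_assoc]
    · rw [List.length_append]; omega

theorem IsLMR.balanced_of_eventually (h : IsLMR σ) {a : Bool} {N : ℕ}
    (ha : ∀ i, σ (N + i) = sturmSub a) {n : ℕ} (hn : 1 ≤ n) :
    ∃ C : ℕ, ∀ v : List Bool, v.length = n → ∀ w ∈ LangSeq σ, ∀ w' ∈ LangSeq σ,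
      w.length = w'.length → |(occ v w : ℤ) - (occ v w' : ℤ)| ≤ (C : ℤ) := by
  have hlen : n ≤ (applyS (seg0 σ N) (List.replicate n a)).length := by
    simpa using length_le_length_applyS (h.seg0_ne_nil N) (List.replicate n a)
  refine exists_bound_of_common_suffix (Y := {y | ∃ j, y = List.replicate j a})
    (fun y ⟨j, hj⟩ x hx => infix_replicate (hj ▸ hx)) (letterBalanced_replicate a)
    (τ := fun _ => applyS (seg0 σ N) (List.replicate n a))
    (fun _ => List.length_pos_iff.1 (hn.trans hlen)) hn
    (K := 2 * ((seg0 σ N true).length + (seg0 σ N false).length) +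
      n * ((seg0 σ N true).length + (seg0 σ N false).length))
    (hlen.trans (Nat.le_succ _)) (fun _ => List.suffix_rfl) fun w hw => ?_
  obtain ⟨r, b, hw⟩ := exists_of_mem_LangSeq hw N
  simp only [ha] at hw
  obtain ⟨l, q, t, e, hl, ht⟩ := exists_of_infix_applyS_cons_replicate _ a hn
    (hw.trans (applyS_infix _ (seg0_sturmSub_infix a r b))) rfl
  exact ⟨l, _, t, e, ⟨q, rfl⟩, hl, ht⟩

theorem IsLMR.balanced (h : IsLMR σ) (hinf : {k | σ k ≠ Msub}.Infinite) {n : ℕ} (hn : 1 ≤ n) :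
    ∃ C : ℕ, ∀ v : List Bool, v.length = n → ∀ w ∈ LangSeq σ, ∀ w' ∈ LangSeq σ,
      w.length = w'.length → |(occ v w : ℤ) - (occ v w' : ℤ)| ≤ (C : ℤ) := by
  obtain ⟨a, ha⟩ : ∃ a, {k | σ k = sturmSub a}.Infinite := by
    by_contra! hfin
    refine hinf (((hfin true).union (hfin false)).subset fun k hk => ?_)
    rcases h k with ⟨a, ha⟩ | hM
    · cases a
      · exact .inr ha
      · exact .inl ha
    · exact absurd hM hk
  by_cases ha' : {k | σ k ≠ sturmSub a}.Infinite
  · exact h.balanced_of_infinite ha ha' hn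
  · obtain ⟨N, hN⟩ := (Set.not_infinite.1 ha').bddAbove
    refine h.balanced_of_eventually (a := a) (N := N + 1) (fun i => ?_) hn
    by_contra hne
    have := hN hne
    omega

end Balanced

/-! ### Eventually only `M`: failure of balance -/

section Unbalanced

theorem applyS_Msub_prefix_iff {v u : List Bool} :
    applyS Msub v <+: applyS Msub u ↔ v <+: u := by
  induction v generalizing u with
  | nil => simp
  | cons c v ih =>
    cases u with
    | nil => simp [Msub_apply]
    | cons d u =>
      simp only [applyS_cons, Msub_apply, List.cons_append, List.nil_append,
        List.cons_prefix_cons, ih, Bool.not_inj_iff]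
      tauto

theorem eq_of_applyS_Msub_prefix_cons {v u : List Bool} {x : Bool}
    (h : applyS Msub v <+: x :: applyS Msub u) : ∀ c ∈ v, c = x := by
  induction v generalizing u with
  | nil => simp
  | cons c v ih =>
    cases u with
    | nil => simp [Msub_apply] at h
    | cons d u =>
      simp only [applyS_cons, Msub_apply, List.cons_append, List.nil_append,
        List.cons_prefix_cons] at h
      obtain ⟨rfl, rfl, h⟩ := h
      rw [Bool.not_not] at h
      simpa using ih h

theorem occ_applyS_Msub {v : List Bool} (ht : true ∈ v) (hf : false ∈ v) (u : List Bool) :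
    occ (applyS Msub v) (applyS Msub u) = occ v u := by
  have hv : v ≠ [] := List.ne_nil_of_mem ht
  have hMv : applyS Msub v ≠ [] := by
    cases v with
    | nil => exact absurd rfl hv
    | cons c v => simp [Msub_apply]
  induction u with
  | nil => rw [applyS_nil, occ_nil_right hv, occ_nil_right hMv]
  | cons d u ih =>
    have h1 := applyS_Msub_prefix_iff (v := v) (u := d :: u)
    have h2 : ¬ applyS Msub v <+: (!d) :: applyS Msub u := fun h => by
      have h3 := eq_of_applyS_Msub_prefix_cons h
      have := (h3 _ ht).trans (h3 _ hf).symm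
      contradiction
    simp only [applyS_cons, Msub_apply, List.cons_append, List.nil_append] at h1 ⊢
    rw [occ_cons, occ_cons, occ_cons, ih]
    simp only [h1, h2, if_false, zero_add]

theorem applyS_sturmSub_prefix_iff {a : Bool} {v u : List Bool} :
    applyS (sturmSub a) v <+: applyS (sturmSub a) u ↔ v <+: u := by
  induction v generalizing u with
  | nil => simp
  | cons c v ih =>
    cases u with
    | nil => simp [sturmSub_ne_nil]
    | cons d u =>
      have h₀ : ∀ c : Bool, c = a ∨ c = !a := by intro c; cases c <;> cases a <;> simp
      rcases h₀ c with rfl | rfl <;> rcases h₀ d with rfl | rfl <;>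
        simp [List.cons_prefix_cons, ih]

theorem occ_applyS_sturmSub_not (a : Bool) (v u : List Bool) :
    occ (applyS (sturmSub a) ((!a) :: v)) (applyS (sturmSub a) u) = occ ((!a) :: v) u := by
  induction u with
  | nil => simp [occ_nil_right]
  | cons d u ih =>
    have h := applyS_sturmSub_prefix_iff (a := a) (v := (!a) :: v) (u := d :: u)
    have h₀ : d = a ∨ d = !a := by cases d <;> cases a <;> simp
    rcases h₀ with rfl | rfl
    · simp only [applyS_cons, sturmSub_self, sturmSub_not, List.cons_append, List.nil_append]
        at h ih ⊢
      rw [occ_cons, occ_cons, ih]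
      simp only [h]
    · simp only [applyS_cons, sturmSub_not, List.cons_append, List.nil_append] at h ih ⊢
      rw [occ_cons, occ_cons, occ_cons, ih]
      simp [List.cons_prefix_cons, applyS_sturmSub_prefix_iff]

theorem occ_cons_applyS_sturmSub (a : Bool) (v u : List Bool) :
    occ (a :: applyS (sturmSub a) v) (applyS (sturmSub a) u) =
      occ (a :: v) u + occ ((!a) :: v) u := by
  induction u with
  | nil => simp [occ_nil_right]
  | cons d u ih =>
    have h₀ : d = a ∨ d = !a := by cases d <;> cases a <;> simp
    rcases h₀ with rfl | rfl
    · simp only [applyS_cons, sturmSub_self, List.cons_append, List.nil_append]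
      rw [occ_cons, occ_cons, occ_cons, ih]
      simp [List.cons_prefix_cons, applyS_sturmSub_prefix_iff]
      omega
    · simp only [applyS_cons, sturmSub_not, List.cons_append, List.nil_append]
      rw [occ_cons, occ_cons, occ_cons, occ_cons, ih]
      simp [List.cons_prefix_cons, applyS_sturmSub_prefix_iff]
      omega

/-- Every word containing both letters has about the same number of occurrences in `f i` and
`g i`, uniformly in `i`. -/
def NonconstBalanced {ι : Type*} (f g : ι → List Bool) : Prop :=
  ∀ v : List Bool, true ∈ v → false ∈ v →
    ∃ C : ℕ, ∀ i, |(occ v (f i) : ℤ) - (occ v (g i) : ℤ)| ≤ (C : ℤ)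

variable {ι : Type*} {f g : ι → List Bool}

theorem NonconstBalanced.of_Msub
    (h : NonconstBalanced (fun i => applyS Msub (f i)) fun i => applyS Msub (g i)) :
    NonconstBalanced f g := by
  intro v ht hf
  obtain ⟨C, hC⟩ := h (applyS Msub v) ((infix_applyS_of_mem ht).subset (by simp [Msub]))
    ((infix_applyS_of_mem ht).subset (by simp [Msub]))
  refine ⟨C, fun i => ?_⟩
  simpa only [occ_applyS_Msub ht hf] using hC i

theorem NonconstBalanced.of_sturmSub {a : Bool}
    (h : NonconstBalanced (fun i => applyS (sturmSub a) (f i)) fun i => applyS (sturmSub a) (g i)) :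
    NonconstBalanced f g := by
  have mem_of : ∀ w : List Bool, a ∈ w → (!a) ∈ w → true ∈ w ∧ false ∈ w := by
    intro w h1 h2
    cases a <;> simp_all
  have mem_not : ∀ w : List Bool, true ∈ w → false ∈ w → (!a) ∈ w := by
    intro w h1 h2
    cases a <;> simp_all
  have hnot : ∀ v, ∃ C : ℕ, ∀ i,
      |(occ ((!a) :: v) (f i) : ℤ) - (occ ((!a) :: v) (g i) : ℤ)| ≤ (C : ℤ) := by
    intro v
    obtain ⟨h1, h2⟩ := mem_of (applyS (sturmSub a) ((!a) :: v)) (by simp) (by simp)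
    obtain ⟨C, hC⟩ := h _ h1 h2
    refine ⟨C, fun i => ?_⟩
    simpa only [occ_applyS_sturmSub_not] using hC i
  intro v ht hf
  obtain _ | ⟨c, v⟩ := v
  · simp at ht
  have h₀ : c = a ∨ c = !a := by cases c <;> cases a <;> simp
  rcases h₀ with rfl | rfl
  · have hv : (!c) ∈ v := by
      have := mem_not _ ht hf
      simpa using this
    obtain ⟨h1, h2⟩ := mem_of (c :: applyS (sturmSub c) v) (by simp)
      (List.mem_cons_of_mem _ ((infix_applyS_of_mem hv).subset (by simp)))
    obtain ⟨C, hC⟩ := h _ h1 h2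
    obtain ⟨C', hC'⟩ := hnot v
    refine ⟨C + C', fun i => ?_⟩
    have e1 := hC i
    have e2 := hC' i
    simp only [occ_cons_applyS_sturmSub] at e1
    push_cast at e1 ⊢
    rw [abs_le] at *
    constructor <;> omega
  · exact hnot v

theorem NonconstBalanced.of_seg0 {σ : ℕ → Bool → List Bool} (hσ : IsLMR σ) (N : ℕ)
    (h : NonconstBalanced (fun i => applyS (seg0 σ N) (f i)) fun i => applyS (seg0 σ N) (g i)) :
    NonconstBalanced f g := by
  induction N generalizing σ with
  | zero =>
    have e : ∀ u, applyS (seg0 σ 0) u = u := applyS_singleton_fun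
    simpa only [e] using h
  | succ N ih =>
    have e : ∀ u, applyS (seg0 σ (N + 1)) u =
        applyS (σ 0) (applyS (seg0 (fun i => σ (i + 1)) N) u) := fun u => by
      rw [applyS_applyS]
      congr 1
      funext b
      exact seg0_one_add σ N b
    simp only [e] at h
    refine ih (σ := fun i => σ (i + 1)) (fun i => hσ (i + 1)) ?_
    rcases hσ 0 with ⟨a, ha⟩ | hM
    · rw [ha] at h
      exact h.of_sturmSub
    · rw [hM] at h
      exact h.of_Msub

/-- The factors of the Thue–Morse words. -/
abbrev thueMorse : Set (List Bool) := segFactors fun _ => Msub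

theorem isLMR_Msub : IsLMR fun _ => Msub := fun _ => .inr rfl

theorem applyS_Msub_mem_thueMorse {u : List Bool} (h : u ∈ thueMorse) :
    applyS Msub u ∈ thueMorse := by
  obtain ⟨n, a, h⟩ := h
  refine ⟨n + 1, a, ?_⟩
  rw [seg0_one_add]
  exact applyS_infix _ h

theorem occ_false_true_Msub (u : List Bool) :
    occ [false, true] (applyS Msub u) + occ [false, true] u +
      (if u.head? = some true then 1 else 0) = u.length := by
  induction u with
  | nil => simp [occ_nil_right]
  | cons a u ih =>
    rw [applyS_cons, Msub_apply, List.cons_append, List.singleton_append, occ_cons, occ_cons,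
      occ_cons, List.length_cons]
    cases u with
    | nil => cases a <;> simp [occ_nil_right, List.cons_prefix_cons]
    | cons b u =>
      cases a <;> cases b <;>
        simp [List.cons_prefix_cons, Msub_apply] at ih ⊢ <;> omega

theorem length_applyS_Msub (u : List Bool) : (applyS Msub u).length = 2 * u.length := by
  have := List.count_true_add_count_false u
  rw [length_applyS_bool]
  simp [Msub]; omega

theorem occ_false_true_Msub_Msub (u : List Bool) :
    occ [false, true] (applyS Msub (applyS Msub u)) = occ [false, true] u + u.length := by
  have h1 := occ_false_true_Msub u
  have h2 := occ_false_true_Msub (applyS Msub u)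
  have h3 : (applyS Msub u).head? = u.head? := by
    cases u <;> simp [Msub_apply]
  have h4 := length_applyS_Msub u
  rw [h3] at h2
  omega

theorem occ_append_ge {A : Type*} [DecidableEq A] {v : List A} (hv : v ≠ []) (w p : List A) :
    occ v w + occ v p ≤ occ v (w ++ p) := by
  induction w with
  | nil => simp [occ_nil_right hv]
  | cons a w ih =>
    have : v <+: a :: w → v <+: a :: (w ++ p) := fun h => h.trans (List.prefix_append (a :: w) p)
    rw [List.cons_append, occ_cons, occ_cons]
    split_ifs <;> first | omega | tauto

/-- The fourth power of the Thue–Morse substitution. -/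
def thueMorse4 (w : List Bool) : List Bool :=
  applyS Msub (applyS Msub (applyS Msub (applyS Msub w)))

theorem length_thueMorse4 (w : List Bool) : (thueMorse4 w).length = 16 * w.length := by
  simp only [thueMorse4, length_applyS_Msub]; omega

theorem occ_thueMorse4_append (w z : List Bool) :
    occ [false, true] (thueMorse4 (w ++ [false]) ++ z) =
      occ [false, true] (w ++ [false]) + 5 * (w ++ [false]).length +
        occ [false, true] (false :: z) := by
  have h1 : occ [false, true] (thueMorse4 (w ++ [false])) =
      occ [false, true] (w ++ [false]) + 5 * (w ++ [false]).length := by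
    rw [thueMorse4, occ_false_true_Msub_Msub, occ_false_true_Msub_Msub, length_applyS_Msub,
      length_applyS_Msub]
    omega
  obtain ⟨q, hq⟩ : ∃ q, thueMorse4 (w ++ [false]) = q ++ [false] := by
    refine ⟨thueMorse4 w ++ [false, true, true, false, true, false, false, true, true, false,
      false, true, false, true, true], ?_⟩
    simp [thueMorse4, Msub]
  have h2 := occ_overlap (v := [false, true]) (s := [false]) (by simp) q z
  have h3 : occ [false, true] [false] = 0 := by decide
  rw [← h1, hq, List.append_assoc]
  rw [List.singleton_append] at h2 ⊢
  omega

theorem thueMorse4_mem {w z y : List Bool} {c : Bool} (h : w ++ [c] ∈ thueMorse)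
    (hz : z ++ y = thueMorse4 [c]) : thueMorse4 w ++ z ∈ thueMorse := by
  have h' : thueMorse4 (w ++ [c]) ∈ thueMorse := by
    iterate 4 apply applyS_Msub_mem_thueMorse
    exact h
  refine segFactors_closed _ _ h' _ (List.IsPrefix.isInfix ⟨y, ?_⟩)
  rw [List.append_assoc, hz]
  simp [thueMorse4]

theorem exists_thueMorse_discrepancy (k : ℕ) : ∃ w w' : List Bool,
    w ++ [false, true] ∈ thueMorse ∧ w' ++ [false, false] ∈ thueMorse ∧
    (w' ++ [false]).length = 2 * (w ++ [false]).length ∧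
    3 * occ [false, true] (w ++ [false]) + 1 = (w ++ [false]).length + k ∧
    3 * occ [false, true] (w' ++ [false]) + k + 2 = (w' ++ [false]).length := by
  induction k with
  | zero =>
    refine ⟨[], [true], ⟨1, false, ?_⟩, ⟨3, false, ?_⟩, rfl, by decide, by decide⟩ <;> decide
  | succ k ih =>
    obtain ⟨w, w', h1, h2, h3, h4, h5⟩ := ih
    have m1 := thueMorse4_mem (w := w ++ [false]) (c := true)
      (z := [true, false, false, true, false, true])
      (y := [true, false, false, true, true, false, true, false, false, true])
      (by simpa using h1) (by decide)
    have m2 := thueMorse4_mem (w := w' ++ [false]) (c := false)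
      (z := [false, true, true, false, true, false, false, true, true, false, false])
      (y := [true, false, true, true, false])
      (by simpa using h2) (by decide)
    have o1 := occ_thueMorse4_append w [true, false, false, true, false]
    have o2 := occ_thueMorse4_append w'
      [false, true, true, false, true, false, false, true, true, false]
    have d1 : occ [false, true] [false, true, false, false, true, false] = 2 := by decide
    have d2 : occ [false, true]
      [false, false, true, true, false, true, false, false, true, true, false] = 3 := by decide
    have l1 := length_thueMorse4 (w ++ [false])
    have l2 := length_thueMorse4 (w' ++ [false])
    rw [d1] at o1
    rw [d2] at o2
    refine ⟨thueMorse4 (w ++ [false]) ++ [true, false, false, true],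
      thueMorse4 (w' ++ [false]) ++ [false, true, true, false, true, false, false, true, true],
      by simpa using m1, by simpa using m2, ?_, ?_, ?_⟩
    all_goals simp only [List.append_assoc, List.cons_append, List.nil_append,
      List.length_append, List.length_cons, List.length_nil] at *
    all_goals omega

/-- Pairs of Thue–Morse factors of the same length. -/
abbrev ThueMorsePair : Type :=
  {p : List Bool × List Bool // p.1 ∈ thueMorse ∧ p.2 ∈ thueMorse ∧ p.1.length = p.2.length}

theorem not_nonconstBalanced_thueMorse :
    ¬ NonconstBalanced (fun p : ThueMorsePair => p.1.1) fun p => p.1.2 := by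
  intro h
  obtain ⟨C, hC⟩ := h [false, true] (by simp) (by simp)
  obtain ⟨w, w', h1, h2, h3, h4, h5⟩ := exists_thueMorse_discrepancy (2 * C + 1)
  have closed := segFactors_closed fun _ => Msub
  have hw : w ++ [false] ∈ thueMorse := closed _ h1 _ ⟨[], [true], by simp⟩
  have hw' : w' ++ [false] ∈ thueMorse := closed _ h2 _ ⟨[], [false], by simp⟩
  generalize w ++ [false] = x at *
  generalize w' ++ [false] = y at *
  obtain ⟨p, q, rfl, hp⟩ : ∃ p q, y = p ++ q ∧ p.length = x.length :=
    ⟨y.take x.length, y.drop x.length, by simp, by simp; omega⟩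
  have hq : q.length = x.length := by
    rw [List.length_append] at h3; omega
  have e1 := hC ⟨(x, p), hw, closed _ hw' _ List.infix_append_left, hp.symm⟩
  have e2 := hC ⟨(x, q), hw, closed _ hw' _ List.infix_append_right, hq.symm⟩
  have e3 := occ_append_ge (v := [false, true]) (by simp) p q
  simp only [abs_le] at e1 e2
  omega

theorem applyS_seg0_mem_LangSeq {σ : ℕ → Bool → List Bool} {N : ℕ} (hN : ∀ i, σ (N + i) = Msub)
    {u : List Bool} (hu : u ∈ thueMorse) : applyS (seg0 σ N) u ∈ LangSeq σ := by
  obtain ⟨n, a, hu⟩ := hu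
  refine Set.infinite_of_forall_exists_gt fun m => ?_
  obtain ⟨b, hb⟩ := isLMR_Msub.exists_seg0_infix (show n < n + m + 1 by omega)
  refine ⟨N + (n + m + 1), ?_, by omega⟩
  refine ⟨b, ?_⟩
  rw [seg0_add]
  simp only [hN]
  exact applyS_infix _ (hu.trans (hb a))

theorem LangSeq_closed {σ : ℕ → Bool → List Bool} {w x : List Bool} (hw : w ∈ LangSeq σ)
    (hx : x <:+: w) : x ∈ LangSeq σ := by
  have h : {n : ℕ | ∃ a : Bool, w <:+: seg0 σ n a}.Infinite := hw
  change {n : ℕ | ∃ a : Bool, x <:+: seg0 σ n a}.Infinite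
  refine h.mono ?_
  rintro n ⟨a, ha⟩
  exact ⟨a, hx.trans ha⟩

theorem occ_close_of_balanced {X : Set (List Bool)} (hX : ∀ w ∈ X, ∀ x, x <:+: w → x ∈ X)
    {v : List Bool} (hv : v ≠ []) {C D : ℕ}
    (h : ∀ w ∈ X, ∀ w' ∈ X, w.length = w'.length → |(occ v w : ℤ) - (occ v w' : ℤ)| ≤ (C : ℤ))
    {w w' : List Bool} (hw : w ∈ X) (hw' : w' ∈ X) (hlen : w.length ≤ w'.length + D) :
    occ v w ≤ occ v w' + (C + v.length + D) := by
  obtain ⟨p, q, rfl, hpq⟩ : ∃ p q, w = p ++ q ∧ p.length = min w.length w'.length :=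
    ⟨w.take w'.length, w.drop w'.length, by simp, by simp [min_comm]⟩
  have hp : p ∈ X := hX _ hw _ List.infix_append_left
  have h1 := occ_append_le hv p q
  have h2 := h p hp (w'.take p.length) (hX _ hw' _ (List.take_prefix _ _).isInfix)
    (by simp; omega)
  have h3 := le_occ_append_right hv (w'.take p.length) (w'.drop p.length)
  rw [List.take_append_drop] at h3
  rw [List.length_append] at hlen hpq
  rw [abs_le] at h2
  omega

theorem IsLMR.infinite_of_balanced {σ : ℕ → Bool → List Bool} (hσ : IsLMR σ)
    (h : ∀ n : ℕ, 1 ≤ n → ∃ C : ℕ, ∀ v : List Bool, v.length = n →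
      ∀ w ∈ LangSeq σ, ∀ w' ∈ LangSeq σ, w.length = w'.length →
        |(occ v w : ℤ) - (occ v w' : ℤ)| ≤ (C : ℤ)) :
    {k | σ k ≠ Msub}.Infinite := by
  by_contra hfin
  obtain ⟨N, hN⟩ := (Set.not_infinite.1 hfin).bddAbove
  have hM : ∀ i, σ (N + 1 + i) = Msub := fun i => by
    by_contra hne
    have := hN hne
    omega
  refine not_nonconstBalanced_thueMorse (NonconstBalanced.of_seg0 hσ (N + 1) fun v ht _ => ?_)
  have hv : v ≠ [] := List.ne_nil_of_mem ht
  obtain ⟨C, hC⟩ := h v.length (List.length_pos_iff.2 hv)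
  set τ := seg0 σ (N + 1)
  set D := 2 * ((τ true).length + (τ false).length)
  have key : ∀ x ∈ thueMorse, ∀ y ∈ thueMorse, x.length = y.length →
      occ v (applyS τ x) ≤ occ v (applyS τ y) + (C + v.length + D) := by
    intro x hx y hy hxy
    refine occ_close_of_balanced (fun w hw x hx => LangSeq_closed hw hx) hv (hC v rfl)
      (applyS_seg0_mem_LangSeq hM hx) (applyS_seg0_mem_LangSeq hM hy) ?_
    have h1 := isLMR_Msub.letterBalanced_segFactors true x hx y hy hxy.le
    have h2 := isLMR_Msub.letterBalanced_segFactors false x hx y hy hxy.le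
    have h3 := Nat.mul_le_mul_right (τ true).length h1
    have h4 := Nat.mul_le_mul_right (τ false).length h2
    rw [length_applyS_bool, length_applyS_bool]
    rw [add_mul] at h3 h4
    omega
  refine ⟨C + v.length + D, fun ⟨⟨x, y⟩, hx, hy, hxy⟩ => ?_⟩
  have h1 := key x hx y hy hxy
  have h2 := key y hy x hx hxy.symm
  rw [abs_le]
  push_cast
  constructor <;> omega

end Unbalanced

/-- for a sequence `σ` of substitutions from `{L, M, R}`, the language
`L_σ` is factor-balanced if and only if `σ_k ≠ M` for infinitely many `k`. -/
theorem LMR_factor_balanced_iff (σ : ℕ → Bool → List Bool)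
    (hσ : ∀ k : ℕ, σ k = Lsub ∨ σ k = Msub ∨ σ k = Rsub) :
    (∀ n : ℕ, 1 ≤ n → ∃ C : ℕ, ∀ v : List Bool, v.length = n →
      ∀ w ∈ LangSeq σ, ∀ w' ∈ LangSeq σ, w.length = w'.length →
        |(occ v w : ℤ) - (occ v w' : ℤ)| ≤ (C : ℤ)) ↔
      {k : ℕ | σ k ≠ Msub}.Infinite := by
  have h : IsLMR σ := fun k => by
    rcases hσ k with h | h | h
    · exact .inl ⟨false, h.trans Lsub_eq⟩
    · exact .inr h
    · exact .inl ⟨true, h.trans Rsub_eq⟩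
  exact ⟨h.infinite_of_balanced, fun hinf _ hn => h.balanced hinf hn⟩
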